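/- Let n ≥ 1, let μ ∈ A₁, let 0 < β < 1, let 1 < p < n/β, define q by 1/q = 1/p − β/n, and let 0 < κ < p/q. If b ∈ Lip_{β,μ} and b ≥ 0 a.e. in ℝⁿ, then the commutator [b,M] is bounded from L^{p,κ}(μ) to L^{q,κq/p}(μ^{1−q}, μ): there exists C > 0 such that ‖[b,M](f)‖_{L^{q,κq/p}(μ^{1−q},μ)} ≤ C ‖f‖_{L^{p,κ}(μ)} for every f ∈ L^{p,κ}(μ). -/

import Mathlib

open MeasureTheory

noncomputable section

/-- An axis-parallel cube in `ℝⁿ` (with positive side length). -/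
def IsCube {n : ℕ} (Q : Set (Fin n → ℝ)) : Prop :=
  ∃ (a : Fin n → ℝ) (h : ℝ), 0 < h ∧ Q = Set.univ.pi fun i => Set.Icc (a i) (a i + h)

/-- The average `f_Q = |Q|⁻¹ ∫_Q f` of `f` over `Q`. -/
def cubeAvg {n : ℕ} (Q : Set (Fin n → ℝ)) (f : (Fin n → ℝ) → ℝ) : ℝ :=
  (MeasureTheory.volume Q).toReal⁻¹ * ∫ y in Q, f y

/-- A weight: a nonnegative locally integrable function, positive a.e. -/
def IsWeight {n : ℕ} (μ : (Fin n → ℝ) → ℝ) : Prop :=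
  MeasureTheory.LocallyIntegrable μ ∧ (∀ x, 0 ≤ μ x) ∧
    ∀ᵐ x ∂(MeasureTheory.volume : Measure (Fin n → ℝ)), 0 < μ x

/-- The Muckenhoupt `A₁` class. -/
def IsA1 {n : ℕ} (μ : (Fin n → ℝ) → ℝ) : Prop :=
  IsWeight μ ∧ ∃ C > 0, ∀ Q : Set (Fin n → ℝ), IsCube Q →
    ∀ᵐ x ∂(MeasureTheory.volume.restrict Q), cubeAvg Q μ ≤ C * μ x

/-- The Muckenhoupt `A_p` class for `1 < p < ∞`. -/
def IsAp {n : ℕ} (μ : (Fin n → ℝ) → ℝ) (p : ℝ) : Prop :=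
  IsWeight μ ∧ ∃ C : ℝ, ∀ Q : Set (Fin n → ℝ), IsCube Q →
    cubeAvg Q μ * (cubeAvg Q fun x => μ x ^ (1 - p / (p - 1))) ^ (p - 1) ≤ C

/-- The Muckenhoupt `A_∞` class, `A_∞ = ⋃_{1 ≤ p < ∞} A_p`. -/
def IsAinfty {n : ℕ} (μ : (Fin n → ℝ) → ℝ) : Prop :=
  IsA1 μ ∨ ∃ p : ℝ, 1 < p ∧ IsAp μ p

/-- The set of quantities defining the weighted Lipschitz norm of `b`. -/
def lipSet {n : ℕ} (β : ℝ) (μ b : (Fin n → ℝ) → ℝ) : Set ℝ :=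
  { r | ∃ Q : Set (Fin n → ℝ), IsCube Q ∧
      r = (∫ x in Q, μ x) ^ (-(β / (n : ℝ))) * (∫ x in Q, μ x)⁻¹ *
            ∫ x in Q, |b x - cubeAvg Q b| }

/-- The weighted Lipschitz norm `‖b‖_{Lip_{β,μ}}`. -/
def lipNorm {n : ℕ} (β : ℝ) (μ b : (Fin n → ℝ) → ℝ) : ℝ := sSup (lipSet β μ b)

/-- Membership `b ∈ Lip_{β,μ}`. -/
def MemLip {n : ℕ} (β : ℝ) (μ b : (Fin n → ℝ) → ℝ) : Prop :=
  MeasureTheory.LocallyIntegrable b ∧ BddAbove (lipSet β μ b)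

/-- The set of averages defining the Hardy–Littlewood maximal function at `x`. -/
def hlMaxSet {n : ℕ} (f : (Fin n → ℝ) → ℝ) (x : Fin n → ℝ) : Set ℝ :=
  { r | ∃ Q : Set (Fin n → ℝ), IsCube Q ∧ x ∈ Q ∧
      r = (MeasureTheory.volume Q).toReal⁻¹ * ∫ y in Q, |f y| }

/-- The Hardy–Littlewood maximal function `M(f)(x)`. -/
def hlMax {n : ℕ} (f : (Fin n → ℝ) → ℝ) (x : Fin n → ℝ) : ℝ := sSup (hlMaxSet f x)

/-- The set of quantities defining the sharp maximal function at `x`. -/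
def sharpMaxSet {n : ℕ} (f : (Fin n → ℝ) → ℝ) (x : Fin n → ℝ) : Set ℝ :=
  { r | ∃ Q : Set (Fin n → ℝ), IsCube Q ∧ x ∈ Q ∧
      r = (MeasureTheory.volume Q).toReal⁻¹ * ∫ y in Q, |f y - cubeAvg Q f| }

/-- The sharp maximal function `M♯(f)(x)`. -/
def sharpMax {n : ℕ} (f : (Fin n → ℝ) → ℝ) (x : Fin n → ℝ) : ℝ := sSup (sharpMaxSet f x)

/-- The local maximal function `M_{Q₀}(f)(x)` relative to a cube `Q₀`. -/
def localMax {n : ℕ} (Q₀ : Set (Fin n → ℝ)) (f : (Fin n → ℝ) → ℝ) (x : Fin n → ℝ) : ℝ :=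
  sSup { r | ∃ Q : Set (Fin n → ℝ), IsCube Q ∧ Q ⊆ Q₀ ∧ x ∈ Q ∧
      r = (MeasureTheory.volume Q).toReal⁻¹ * ∫ y in Q, |f y| }

/-- The maximal commutator `M_b(f)(x)`. -/
def maxCommutator {n : ℕ} (b f : (Fin n → ℝ) → ℝ) (x : Fin n → ℝ) : ℝ :=
  sSup { r | ∃ Q : Set (Fin n → ℝ), IsCube Q ∧ x ∈ Q ∧
      r = (MeasureTheory.volume Q).toReal⁻¹ * ∫ y in Q, |b x - b y| * |f y| }

/-- The (nonlinear) commutator `[b, M](f)(x) = b(x) M(f)(x) - M(bf)(x)`. -/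
def commM {n : ℕ} (b f : (Fin n → ℝ) → ℝ) (x : Fin n → ℝ) : ℝ :=
  b x * hlMax f x - hlMax (fun y => b y * f y) x

/-- The commutator `[b, M♯](f)(x) = b(x) M♯(f)(x) - M♯(bf)(x)`. -/
def commSharp {n : ℕ} (b f : (Fin n → ℝ) → ℝ) (x : Fin n → ℝ) : ℝ :=
  b x * sharpMax f x - sharpMax (fun y => b y * f y) x

/-- The weighted fractional maximal function `M_{β,μ,r}(f)(x)`. -/
def fracMax {n : ℕ} (β : ℝ) (μ : (Fin n → ℝ) → ℝ) (r : ℝ) (f : (Fin n → ℝ) → ℝ)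
    (x : Fin n → ℝ) : ℝ :=
  sSup { t | ∃ Q : Set (Fin n → ℝ), IsCube Q ∧ x ∈ Q ∧
      t = ((∫ y in Q, μ y) ^ (-(1 - r * β / (n : ℝ))) * ∫ y in Q, |f y| ^ r * μ y) ^ (1 / r) }

/-- The two-weight Morrey norm `‖f‖_{L^{p,κ}(u,v)}`. -/
def morreyNorm2 {n : ℕ} (p κ : ℝ) (u v f : (Fin n → ℝ) → ℝ) : ℝ :=
  sSup { r | ∃ Q : Set (Fin n → ℝ), IsCube Q ∧
      r = ((∫ x in Q, v x) ^ (-κ) * ∫ x in Q, |f x| ^ p * u x) ^ (1 / p) }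

/-- The one-weight Morrey norm `‖f‖_{L^{p,κ}(μ)}`. -/
def morreyNorm {n : ℕ} (p κ : ℝ) (μ f : (Fin n → ℝ) → ℝ) : ℝ := morreyNorm2 p κ μ μ f

/-- Membership `f ∈ L^{p,κ}(μ)`: local `L^p(μ)`-integrability and finiteness of the norm. -/
def MemMorrey {n : ℕ} (p κ : ℝ) (μ f : (Fin n → ℝ) → ℝ) : Prop :=
  (∀ Q : Set (Fin n → ℝ), IsCube Q →
      MeasureTheory.IntegrableOn (fun x => |f x| ^ p * μ x) Q) ∧
  BddAbove { r | ∃ Q : Set (Fin n → ℝ), IsCube Q ∧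
      r = ((∫ x in Q, μ x) ^ (-κ) * ∫ x in Q, |f x| ^ p * μ x) ^ (1 / p) }

section Helpers
open Metric Set Filter Topology
open scoped ENNReal NNReal

/-- Uncentered maximal function with respect to a measure `ν`. -/
def maxN {n : ℕ} (ν : Measure (Fin n → ℝ)) (h : (Fin n → ℝ) → ℝ≥0∞) (x : Fin n → ℝ) : ℝ≥0∞ :=
  ⨆ (c : Fin n → ℝ) (r : ℝ) (_ : 0 < r) (_ : x ∈ ball c r),
    (ν (closedBall c r))⁻¹ * ∫⁻ y in closedBall c r, h y ∂ν

theorem lt_maxN_iff {n : ℕ} (ν : Measure (Fin n → ℝ)) (h : (Fin n → ℝ) → ℝ≥0∞)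
    (x : Fin n → ℝ) (t : ℝ≥0∞) :
    t < maxN ν h x ↔ ∃ c r, 0 < r ∧ x ∈ ball c r ∧
      t < (ν (closedBall c r))⁻¹ * ∫⁻ y in closedBall c r, h y ∂ν := by
  simp only [maxN, lt_iSup_iff, exists_prop]

theorem maxN_measurable {n : ℕ} (ν : Measure (Fin n → ℝ)) (h : (Fin n → ℝ) → ℝ≥0∞) :
    Measurable (maxN ν h) := by
  apply measurable_of_Ioi
  intro t
  apply IsOpen.measurableSet
  have : maxN ν h ⁻¹' Ioi t = ⋃ (c : Fin n → ℝ) (r : ℝ) (_ : 0 < r ∧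
      t < (ν (closedBall c r))⁻¹ * ∫⁻ y in closedBall c r, h y ∂ν), ball c r := by
    ext x
    simp only [mem_preimage, mem_Ioi, lt_maxN_iff, mem_iUnion, exists_prop]
    grind
  rw [this]
  exact isOpen_iUnion fun c => isOpen_iUnion fun r => isOpen_iUnion fun _ => isOpen_ball

/-- The properties of the measure that are used. -/
structure GoodM {n : ℕ} (ν : Measure (Fin n → ℝ)) (D : ℝ≥0∞) : Prop where
  pos : ∀ c r, 0 < r → ν (closedBall c r) ≠ 0
  fin : ∀ c r, ν (closedBall c r) ≠ ∞
  Dfin : D ≠ ∞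
  dbl : ∀ c r, 0 < r → ν (closedBall c (4 * r)) ≤ D * ν (closedBall c r)

theorem maxN_weak {n : ℕ} {ν : Measure (Fin n → ℝ)} {D : ℝ≥0∞} (hν : GoodM ν D)
    (h : (Fin n → ℝ) → ℝ≥0∞) (t : ℝ≥0∞) :
    t * ν {x | t < maxN ν h x} ≤ D * ∫⁻ y, h y ∂ν := by
  classical
  let T : ℕ → Set ((Fin n → ℝ) × ℝ) := fun k => {i | 0 < i.2 ∧ i.2 ≤ k ∧
    t < (ν (closedBall i.1 i.2))⁻¹ * ∫⁻ y in closedBall i.1 i.2, h y ∂ν}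
  let E : ℕ → Set (Fin n → ℝ) := fun k => ⋃ i ∈ T k, closedBall i.1 i.2
  have hsub : {x | t < maxN ν h x} ⊆ ⋃ k, E k := by
    intro x hx
    obtain ⟨c, r, hr, hxr, ht⟩ := (lt_maxN_iff ν h x t).1 hx
    obtain ⟨k, hk⟩ := exists_nat_ge r
    simp only [E, mem_iUnion, exists_prop]
    exact ⟨k, (c, r), ⟨hr, hk, ht⟩, ball_subset_closedBall hxr⟩
  have hmono : Monotone E := by
    intro k l hkl
    apply biUnion_subset_biUnion_left
    intro i hi
    exact ⟨hi.1, hi.2.1.trans (by exact_mod_cast hkl), hi.2.2⟩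
  have hE : ∀ k, t * ν (E k) ≤ D * ∫⁻ y, h y ∂ν := by
    intro k
    obtain ⟨u, huT, hud, hu⟩ := Vitali.exists_disjoint_subfamily_covering_enlargement_closedBall
      (T k) (fun i => i.1) (fun i => i.2) k (fun i hi => hi.2.1) 4 (by norm_num)
    have hcount : u.Countable := by
      apply hud.countable_of_nonempty_interior
      intro i hi
      exact (nonempty_ball.2 (huT hi).1).mono ball_subset_interior_closedBall
    have h1 : ν (E k) ≤ ∑' i : u, ν (closedBall i.1.1 (4 * i.1.2)) := by
      have := hcount.to_subtype
      refine le_trans (measure_mono ?_) (measure_iUnion_le _)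
      intro x hx
      simp only [E, mem_iUnion, exists_prop] at hx
      obtain ⟨i, hi, hxi⟩ := hx
      obtain ⟨j, hj, hij⟩ := hu i hi
      exact mem_iUnion.2 ⟨⟨j, hj⟩, hij hxi⟩
    calc t * ν (E k) ≤ t * ∑' i : u, ν (closedBall i.1.1 (4 * i.1.2)) := by gcongr
      _ = ∑' i : u, t * ν (closedBall i.1.1 (4 * i.1.2)) := ENNReal.tsum_mul_left.symm
      _ ≤ ∑' i : u, D * ∫⁻ y in closedBall i.1.1 i.1.2, h y ∂ν := by
        apply ENNReal.tsum_le_tsum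
        intro i
        have hi := huT i.2
        have hp := hν.pos i.1.1 i.1.2 hi.1
        have hf := hν.fin i.1.1 i.1.2
        calc t * ν (closedBall i.1.1 (4 * i.1.2)) ≤ t * (D * ν (closedBall i.1.1 i.1.2)) := by
              gcongr; exact hν.dbl _ _ hi.1
          _ = D * (t * ν (closedBall i.1.1 i.1.2)) := by ring
          _ ≤ D * (((ν (closedBall i.1.1 i.1.2))⁻¹ * ∫⁻ y in closedBall i.1.1 i.1.2, h y ∂ν)
                * ν (closedBall i.1.1 i.1.2)) := by gcongr; exact hi.2.2.le
          _ = D * ∫⁻ y in closedBall i.1.1 i.1.2, h y ∂ν := by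
              rw [mul_comm (ν (closedBall i.1.1 i.1.2))⁻¹, mul_assoc,
                ENNReal.inv_mul_cancel hp hf, mul_one]
      _ = D * ∑' i : u, ∫⁻ y in closedBall i.1.1 i.1.2, h y ∂ν := ENNReal.tsum_mul_left
      _ = D * ∫⁻ y in ⋃ i ∈ u, closedBall i.1 i.2, h y ∂ν := by
        rw [lintegral_biUnion hcount (fun i _ => measurableSet_closedBall) hud]
      _ ≤ D * ∫⁻ y, h y ∂ν := by gcongr; exact Measure.restrict_le_self
  calc t * ν {x | t < maxN ν h x} ≤ t * ν (⋃ k, E k) := by gcongr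
    _ = ⨆ k, t * ν (E k) := by rw [hmono.measure_iUnion, ENNReal.mul_iSup]
    _ ≤ _ := iSup_le hE

theorem maxN_weak' {n : ℕ} {ν : Measure (Fin n → ℝ)} {D : ℝ≥0∞} (hν : GoodM ν D)
    (g : (Fin n → ℝ) → ℝ) (t : ℝ) (ht : 0 < t) (hg : AEMeasurable g ν) :
    ν {x | ENNReal.ofReal t < maxN ν (fun y => ENNReal.ofReal (g y)) x} * ENNReal.ofReal t ≤
      2 * D * ∫⁻ y in {y | t < 2 * g y}, ENNReal.ofReal (g y) ∂ν := by
  have hS : NullMeasurableSet {y | t < 2 * g y} ν :=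
    nullMeasurableSet_lt aemeasurable_const (hg.const_mul 2)
  set h' : (Fin n → ℝ) → ℝ≥0∞ := {y | t < 2 * g y}.indicator (fun y => ENNReal.ofReal (g y)) with hh'
  have h1 : ∀ x, maxN ν (fun y => ENNReal.ofReal (g y)) x ≤ ENNReal.ofReal (t / 2) + maxN ν h' x := by
    intro x
    simp only [maxN]
    refine iSup_le fun c => iSup_le fun r => iSup_le fun hr => iSup_le fun hx => ?_
    have hp := hν.pos c r hr
    have hf := hν.fin c r
    have : ∫⁻ y in closedBall c r, ENNReal.ofReal (g y) ∂ν ≤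
        ENNReal.ofReal (t / 2) * ν (closedBall c r) + ∫⁻ y in closedBall c r, h' y ∂ν := by
      rw [← setLIntegral_const, ← lintegral_add_left measurable_const]
      apply lintegral_mono
      intro y
      by_cases hy : t < 2 * g y
      · simp [hh', hy]
      · have : ENNReal.ofReal (g y) ≤ ENNReal.ofReal (t/2) :=
          ENNReal.ofReal_le_ofReal (by linarith)
        exact this.trans le_self_add
    calc (ν (closedBall c r))⁻¹ * ∫⁻ y in closedBall c r, ENNReal.ofReal (g y) ∂ν
        ≤ (ν (closedBall c r))⁻¹ * (ENNReal.ofReal (t / 2) * ν (closedBall c r)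
          + ∫⁻ y in closedBall c r, h' y ∂ν) := by gcongr
      _ = ENNReal.ofReal (t / 2) + (ν (closedBall c r))⁻¹ * ∫⁻ y in closedBall c r, h' y ∂ν := by
        rw [mul_add, mul_comm (ENNReal.ofReal (t/2)), ← mul_assoc,
          ENNReal.inv_mul_cancel hp hf, one_mul]
      _ ≤ _ := by
        gcongr
        refine le_iSup_of_le c (le_iSup_of_le r (le_iSup_of_le hr (le_iSup_of_le hx le_rfl)))
  have h2 : {x | ENNReal.ofReal t < maxN ν (fun y => ENNReal.ofReal (g y)) x} ⊆
      {x | ENNReal.ofReal (t/2) < maxN ν h' x} := by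
    intro x hx
    have hx1 : ENNReal.ofReal t < _ := hx
    have := hx1.trans_le (h1 x)
    rw [show t = t/2 + t/2 by ring, ENNReal.ofReal_add (by positivity) (by positivity)] at this
    rw [show (t/2 + t/2)/2 = t/2 by ring] at this
    exact lt_of_add_lt_add_left this
  have h3 := maxN_weak hν h' (ENNReal.ofReal (t/2))
  rw [hh', lintegral_indicator₀ hS] at h3
  calc _ ≤ ν {x | ENNReal.ofReal (t/2) < maxN ν h' x} * ENNReal.ofReal t := by gcongr
    _ = 2 * (ENNReal.ofReal (t/2) * ν {x | ENNReal.ofReal (t/2) < maxN ν h' x}) := by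
      rw [show t = 2 * (t/2) by ring, ENNReal.ofReal_mul (by norm_num)]
      rw [show (2 * (t/2))/2 = t/2 by ring]
      simp
      ring
    _ ≤ 2 * (D * _) := by gcongr
    _ = _ := by ring

theorem maxN_strong {n : ℕ} {ν : Measure (Fin n → ℝ)} {D : ℝ≥0∞} (hν : GoodM ν D)
    (p : ℝ) (hp : 1 < p) : ∃ C : ℝ≥0∞, C ≠ ∞ ∧ ∀ g : (Fin n → ℝ) → ℝ, AEMeasurable g ν →
      (∀ x, 0 ≤ g x) →
      ∫⁻ x, maxN ν (fun y => ENNReal.ofReal (g y)) x ^ p ∂ν ≤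
        C * ∫⁻ x, ENNReal.ofReal (g x) ^ p ∂ν := by
  have hp0 : 0 < p := by linarith
  have hp1 : 0 < p - 1 := by linarith
  refine ⟨ENNReal.ofReal p * (2 * D * ((ENNReal.ofReal (p-1))⁻¹ * ENNReal.ofReal (2 ^ (p-1)))), ?_, ?_⟩
  · have := hν.Dfin
    have : (ENNReal.ofReal (p-1))⁻¹ ≠ ∞ := by simp [hp]
    finiteness
  intro g hg hg0
  set N := maxN ν (fun y => ENNReal.ofReal (g y)) with hN
  have hNm : Measurable N := maxN_measurable _ _
  have key : ∀ m : ℕ, ∫⁻ x, (min (N x) m) ^ p ∂ν ≤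
      ENNReal.ofReal p * (2 * D * ((ENNReal.ofReal (p-1))⁻¹ * ENNReal.ofReal (2 ^ (p-1)))) *
        ∫⁻ x, ENNReal.ofReal (g x) ^ p ∂ν := by
    intro m
    have e1 : ∀ x, (min (N x) m) ^ p = ENNReal.ofReal ((min (N x) m).toReal ^ p) := by
      intro x
      rw [← ENNReal.ofReal_rpow_of_nonneg ENNReal.toReal_nonneg hp0.le, ENNReal.ofReal_toReal]
      exact ne_top_of_le_ne_top (ENNReal.natCast_ne_top m) (min_le_right _ _)
    simp_rw [e1]
    rw [lintegral_rpow_eq_lintegral_meas_lt_mul ν (ae_of_all _ fun x => ENNReal.toReal_nonneg)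
      ((hNm.min measurable_const).ennreal_toReal.aemeasurable) hp0]
    set ρ := ν.withDensity (fun y => ENNReal.ofReal (g y)) with hρ
    have hac : ρ ≪ ν := withDensity_absolutelyContinuous _ _
    have e2 := lintegral_rpow_eq_lintegral_meas_lt_mul ρ (f := fun y => 2 * g y)
      (ae_of_all _ fun x => by simpa using hg0 x) ((hg.const_mul 2).mono_ac hac) hp1
    have e3 : ∫⁻ t in Ioi (0:ℝ), ν {a | t < (min (N a) m).toReal} * ENNReal.ofReal (t ^ (p-1)) ≤
        2 * D * ∫⁻ t in Ioi (0:ℝ), ρ {a | t < 2 * g a} * ENNReal.ofReal (t ^ (p - 1 - 1)) := by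
      rw [← lintegral_const_mul' _ _ (by have := hν.Dfin; finiteness)]
      apply setLIntegral_mono' measurableSet_Ioi
      intro t ht
      have ht : 0 < t := ht
      have hS : NullMeasurableSet {y | t < 2 * g y} ν :=
        nullMeasurableSet_lt aemeasurable_const (hg.const_mul 2)
      rw [hρ, withDensity_apply₀ _ hS, ← mul_assoc]
      have hw := maxN_weak' hν g t ht hg
      have hsub : {a | t < (min (N a) m).toReal} ⊆ {x | ENNReal.ofReal t < N x} := by
        intro a ha
        have ha : t < (min (N a) m).toReal := ha
        have := (ENNReal.ofReal_lt_iff_lt_toReal ht.le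
          (ne_top_of_le_ne_top (ENNReal.natCast_ne_top m) (min_le_right (N a) _))).2 ha
        exact this.trans_le (min_le_left _ _)
      have : t ^ (p-1) = t * t ^ (p-1-1) := by
        rw [Real.rpow_sub_one ht.ne' (p-1)]; field_simp
      rw [this, ENNReal.ofReal_mul ht.le, ← mul_assoc]
      gcongr ?_ * _
      refine le_trans ?_ hw
      gcongr
    have e4 : ∫⁻ y, ENNReal.ofReal ((2 * g y) ^ (p-1)) ∂ρ =
        ENNReal.ofReal (2 ^ (p-1)) * ∫⁻ x, ENNReal.ofReal (g x) ^ p ∂ν := by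
      rw [hρ, lintegral_withDensity_eq_lintegral_mul₀ (by fun_prop) (by fun_prop),
        ← lintegral_const_mul' _ _ (by finiteness)]
      apply lintegral_congr
      intro x
      simp only [Pi.mul_apply]
      rw [ENNReal.ofReal_rpow_of_nonneg (hg0 x) hp0.le, ← ENNReal.ofReal_mul (hg0 x),
        ← ENNReal.ofReal_mul (by positivity)]
      congr 1
      rw [Real.mul_rpow (by norm_num) (hg0 x)]
      rcases (hg0 x).eq_or_lt with h | h
      · rw [← h, Real.zero_rpow hp0.ne']; simp
      · rw [Real.rpow_sub_one h.ne']; field_simp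
    have e5 : ∫⁻ t in Ioi (0:ℝ), ρ {a | t < 2 * g a} * ENNReal.ofReal (t ^ (p - 1 - 1)) =
        (ENNReal.ofReal (p-1))⁻¹ * (ENNReal.ofReal (2 ^ (p-1)) * ∫⁻ x, ENNReal.ofReal (g x) ^ p ∂ν) := by
      rw [← e4, e2, ← mul_assoc, ENNReal.inv_mul_cancel (by simp [hp]) (by finiteness), one_mul]
    rw [e5] at e3
    refine (mul_le_mul_right e3 (ENNReal.ofReal p)).trans (le_of_eq ?_)
    ring
  have hmono : Monotone fun (m : ℕ) (x : Fin n → ℝ) => (min (N x) m) ^ p := by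
    intro k l hkl x
    dsimp only
    gcongr
  have hsup : ∀ x, N x ^ p = ⨆ m : ℕ, (min (N x) m) ^ p := by
    intro x
    apply le_antisymm
    · have : Tendsto (fun m : ℕ => (min (N x) m) ^ p) atTop (𝓝 ((min (N x) ∞) ^ p)) :=
        ((tendsto_const_nhds.min ENNReal.tendsto_nat_nhds_top).ennrpow_const p)
      rw [min_eq_left le_top] at this
      exact le_of_tendsto' this fun m => le_iSup (fun m : ℕ => (min (N x) m) ^ p) m
    · exact iSup_le fun m => by gcongr; exact min_le_left _ _
  simp_rw [hsup]
  rw [lintegral_iSup (fun m => (hNm.min measurable_const).pow_const p) hmono]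
  exact iSup_le key

theorem isCube_iff {n : ℕ} (Q : Set (Fin n → ℝ)) :
    IsCube Q ↔ ∃ c r, 0 < r ∧ Q = closedBall c r := by
  constructor
  · rintro ⟨a, h, hh, rfl⟩
    refine ⟨fun i => a i + h / 2, h / 2, by positivity, ?_⟩
    rw [closedBall_pi _ (by positivity)]
    congr 1
    ext i y
    simp only [Real.closedBall_eq_Icc]
    rw [show a i + h / 2 - h / 2 = a i by ring, show a i + h / 2 + h / 2 = a i + h by ring]
  · rintro ⟨c, r, hr, rfl⟩
    refine ⟨fun i => c i - r, 2 * r, by positivity, ?_⟩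
    rw [closedBall_pi _ hr.le]
    congr 1
    ext i y
    simp only [Real.closedBall_eq_Icc]
    rw [show c i - r + 2 * r = c i + r by ring]

theorem volR {n : ℕ} (c : Fin n → ℝ) (r : ℝ) (hr : 0 < r) :
    (volume (closedBall c r)).toReal = (2 * r) ^ n := by
  rw [Real.volume_pi_closedBall c hr.le, ENNReal.toReal_ofReal (by positivity)]
  simp

theorem volpos {n : ℕ} (c : Fin n → ℝ) (r : ℝ) (hr : 0 < r) :
    0 < (volume (closedBall c r)).toReal := by
  rw [volR c r hr]; positivity

/-- The center of the shrunk cube. -/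
def shr {n : ℕ} (x c : Fin n → ℝ) (k : ℕ) : Fin n → ℝ := x + ((1/2 : ℝ) ^ k) • (c - x)

theorem shr_zero {n : ℕ} (x c : Fin n → ℝ) : shr x c 0 = c := by simp [shr]

theorem mem_shr {n : ℕ} {x c : Fin n → ℝ} {r : ℝ} (hx : x ∈ closedBall c r) (k : ℕ) :
    x ∈ closedBall (shr x c k) ((1/2 : ℝ) ^ k * r) := by
  rw [mem_closedBall, dist_eq_norm] at *
  have : x - shr x c k = ((1/2 : ℝ) ^ k) • (x - c) := by
    simp only [shr]; module
  rw [this, norm_smul, Real.norm_of_nonneg (by positivity)]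
  gcongr

theorem shr_sub {n : ℕ} {x c : Fin n → ℝ} {r : ℝ} (hx : x ∈ closedBall c r) (k : ℕ) :
    closedBall (shr x c (k+1)) ((1/2 : ℝ) ^ (k+1) * r) ⊆
      closedBall (shr x c k) ((1/2 : ℝ) ^ k * r) := by
  apply closedBall_subset_closedBall'
  rw [mem_closedBall, dist_eq_norm] at *
  have : shr x c (k+1) - shr x c k = ((1/2 : ℝ) ^ (k+1)) • (x - c) := by
    simp only [shr, pow_succ]; module
  rw [this, norm_smul, Real.norm_of_nonneg (by positivity)]
  have h2 : (1/2 : ℝ) ^ (k+1) * ‖x - c‖ ≤ (1/2 : ℝ) ^ (k+1) * r := by gcongr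
  have : (1/2 : ℝ) ^ k * r = (1/2 : ℝ) ^ (k+1) * r + (1/2 : ℝ) ^ (k+1) * r := by
    rw [pow_succ]; ring
  linarith

theorem shr_sub0 {n : ℕ} {x c : Fin n → ℝ} {r : ℝ} (hx : x ∈ closedBall c r) (k : ℕ) :
    closedBall (shr x c k) ((1/2 : ℝ) ^ k * r) ⊆ closedBall c r := by
  induction k with
  | zero => simp [shr_zero]
  | succ k ih => exact (shr_sub hx k).trans ih

theorem shr_tendsto {n : ℕ} {g : (Fin n → ℝ) → ℝ} (hg : LocallyIntegrable g) :
    ∀ᵐ x, ∀ c r, 0 < r → x ∈ closedBall c r →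
      Tendsto (fun k : ℕ => cubeAvg (closedBall (shr x c k) ((1/2 : ℝ) ^ k * r)) g) atTop
        (𝓝 (g x)) := by
  filter_upwards [IsUnifLocDoublingMeasure.ae_tendsto_average volume hg 1] with x hx c r hr hxc
  have h1 : Tendsto (fun k : ℕ => (1/2 : ℝ) ^ k * r) atTop (𝓝[>] 0) := by
    rw [tendsto_nhdsWithin_iff]
    constructor
    · have := (tendsto_pow_atTop_nhds_zero_of_lt_one (r := (1/2:ℝ)) (by norm_num)
        (by norm_num)).mul_const r
      simpa using this
    · exact Eventually.of_forall fun k => by simp only [mem_Ioi]; positivity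
  have := hx (fun k => shr x c k) (fun k : ℕ => (1/2 : ℝ) ^ k * r) h1
    (Eventually.of_forall fun k => by rw [one_mul]; exact mem_shr hxc k)
  simpa only [setAverage_eq, smul_eq_mul, cubeAvg, Measure.real] using this

/-- Pointwise consequence of `A₁`. -/
structure A1c {n : ℕ} (μ : (Fin n → ℝ) → ℝ) (C : ℝ) : Prop where
  li : LocallyIntegrable μ
  nn : ∀ x, 0 ≤ μ x
  pos : ∀ᵐ x, 0 < μ x
  one : 1 ≤ C
  pt : ∀ᵐ x, ∀ c r, 0 < r → x ∈ closedBall c r →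
    ∫ y in closedBall c r, μ y ≤ C * μ x * (volume (closedBall c r)).toReal

theorem io {n : ℕ} {g : (Fin n → ℝ) → ℝ} (hg : LocallyIntegrable g) (c : Fin n → ℝ) (r : ℝ) :
    IntegrableOn g (closedBall c r) := hg.integrableOn_isCompact (isCompact_closedBall c r)

theorem exists_A1c {n : ℕ} {μ : (Fin n → ℝ) → ℝ} (h : IsA1 μ) : ∃ C, A1c μ C := by
  obtain ⟨⟨hli, hnn, hpos⟩, C, hC, hA⟩ := h
  refine ⟨max C 1, hli, hnn, hpos, le_max_right _ _, ?_⟩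
  filter_upwards [shr_tendsto hli] with x hx c r hr hxc
  have h1 : cubeAvg (closedBall c r) μ ≤ C * μ x := by
    refine ge_of_tendsto' ((hx c r hr hxc).const_mul C) fun k => ?_
    have hr' : 0 < (1/2 : ℝ) ^ k * r := by positivity
    have hv := volpos (shr x c k) _ hr'
    have hae := ae_restrict_of_ae_restrict_of_subset (shr_sub0 hxc k)
      (hA (closedBall c r) ((isCube_iff _).2 ⟨c, r, hr, rfl⟩))
    have hitg := io hli (shr x c k) ((1/2 : ℝ) ^ k * r)
    have := setIntegral_mono_ae_restrict (μ := volume) (f := fun _ => cubeAvg (closedBall c r) μ)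
      (g := fun y => C * μ y)
      (integrableOn_const (by rw [← lt_top_iff_ne_top]; exact measure_closedBall_lt_top)) (hitg.const_mul C) hae
    rw [setIntegral_const, integral_const_mul, smul_eq_mul, Measure.real] at this
    conv_rhs => rw [cubeAvg]
    rw [← mul_assoc, mul_comm C, mul_assoc, inv_mul_eq_div, le_div_iff₀ hv]
    linarith
  rw [cubeAvg, inv_mul_eq_div, div_le_iff₀ (volpos c r hr)] at h1
  refine h1.trans ?_
  have := hnn x
  gcongr
  exact le_max_left _ _

theorem A1c.mpos {n : ℕ} {μ : (Fin n → ℝ) → ℝ} {C : ℝ} (h : A1c μ C) (c : Fin n → ℝ) (r : ℝ)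
    (hr : 0 < r) : 0 < ∫ y in closedBall c r, μ y := by
  rw [setIntegral_pos_iff_support_of_nonneg_ae (ae_of_all _ h.nn) (io h.li c r)]
  have hv : 0 < volume (closedBall c r) := measure_closedBall_pos _ _ hr
  refine hv.trans_le (measure_mono_ae ?_)
  filter_upwards [h.pos] with x hx hxc
  exact ⟨hx.ne', hxc⟩

theorem A1c.set {n : ℕ} {μ : (Fin n → ℝ) → ℝ} {C : ℝ} (h : A1c μ C) (c : Fin n → ℝ) (r : ℝ)
    (hr : 0 < r) (E : Set (Fin n → ℝ)) (hE : MeasurableSet E) (hsub : E ⊆ closedBall c r) :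
    (∫ y in closedBall c r, μ y) * (volume E).toReal ≤
      C * (∫ y in E, μ y) * (volume (closedBall c r)).toReal := by
  have hfin : volume E ≠ ∞ := ne_top_of_le_ne_top measure_closedBall_lt_top.ne (measure_mono hsub)
  have hae : ∀ᵐ x ∂(volume.restrict E), ∫ y in closedBall c r, μ y ≤
      C * μ x * (volume (closedBall c r)).toReal := by
    rw [ae_restrict_iff' hE]
    filter_upwards [h.pt] with x hx hxE using hx c r hr (hsub hxE)
  have := setIntegral_mono_ae_restrict (μ := volume) (f := fun _ => ∫ y in closedBall c r, μ y)
      (integrableOn_const hfin)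
      ((((io h.li c r).mono_set hsub).const_mul C).mul_const _) hae
  rw [setIntegral_const, integral_mul_const, integral_const_mul, smul_eq_mul, Measure.real] at this
  linarith

theorem A1c.decay {n : ℕ} (hn : 1 ≤ n) {μ : (Fin n → ℝ) → ℝ} {C : ℝ} (h : A1c μ C)
    {x c : Fin n → ℝ} {r : ℝ} (hr : 0 < r) (hx : x ∈ closedBall c r) (k : ℕ) :
    ∫ y in closedBall (shr x c k) ((1/2 : ℝ) ^ k * r), μ y ≤
      (1 - 1 / (2 * C)) ^ k * ∫ y in closedBall c r, μ y := by
  have hC := h.one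
  induction k with
  | zero => simp [shr_zero]
  | succ k ih =>
    have hθ : 0 ≤ 1 - 1 / (2 * C) := by
      rw [sub_nonneg, div_le_one (by positivity)]; linarith
    set Q := closedBall (shr x c k) ((1/2 : ℝ) ^ k * r) with hQ
    set Q1 := closedBall (shr x c (k+1)) ((1/2 : ℝ) ^ (k+1) * r) with hQ1
    have hsub : Q1 ⊆ Q := shr_sub hx k
    have hr0 : 0 < (1/2 : ℝ) ^ k * r := by positivity
    have hr1 : 0 < (1/2 : ℝ) ^ (k+1) * r := by positivity
    have hs := h.set _ _ hr0 (Q \ Q1) (measurableSet_closedBall.diff measurableSet_closedBall)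
      sdiff_subset
    rw [← hQ] at hs
    have hv : (volume (Q \ Q1)).toReal = (volume Q).toReal - (volume Q1).toReal :=
      measureReal_sdiff hsub measurableSet_closedBall measure_closedBall_lt_top.ne
    have hm : ∫ y in Q \ Q1, μ y = (∫ y in Q, μ y) - ∫ y in Q1, μ y :=
      setIntegral_sdiff measurableSet_closedBall (io h.li _ _) hsub
    have hvQ : 0 < (volume Q).toReal := volpos _ _ hr0
    have hv1 : (volume Q1).toReal ≤ (volume Q).toReal / 2 := by
      rw [hQ, hQ1, volR _ _ hr0, volR _ _ hr1,
        show 2 * ((1/2 : ℝ) ^ (k+1) * r) = (1/2) * (2 * ((1/2 : ℝ) ^ k * r)) by rw [pow_succ]; ring,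
        mul_pow]
      have : (1/2 : ℝ) ^ n ≤ (1/2) ^ 1 := pow_le_pow_of_le_one (by norm_num) (by norm_num) hn
      have h3 : 0 < (2 * ((1/2 : ℝ) ^ k * r)) ^ n := by positivity
      nlinarith
    have hmQ : 0 < ∫ y in Q, μ y := h.mpos _ _ hr0
    rw [hv, hm] at hs
    have h5 : (∫ y in Q, μ y) * ((volume Q).toReal / 2) ≤
        C * ((∫ y in Q, μ y) - ∫ y in Q1, μ y) * (volume Q).toReal := by
      refine le_trans ?_ hs
      gcongr
      linarith
    have h6 : (∫ y in Q, μ y) / 2 ≤ C * ((∫ y in Q, μ y) - ∫ y in Q1, μ y) := by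
      refine le_of_mul_le_mul_right ?_ hvQ
      linarith
    have h7 : ∫ y in Q1, μ y ≤ (1 - 1 / (2 * C)) * ∫ y in Q, μ y := by
      have : (∫ y in Q, μ y) / (2 * C) ≤ (∫ y in Q, μ y) - ∫ y in Q1, μ y := by
        rw [div_le_iff₀ (by positivity)]; linarith
      rw [sub_mul, one_mul, one_div_mul_eq_div]
      linarith
    calc _ ≤ _ := h7
      _ ≤ (1 - 1 / (2 * C)) * ((1 - 1 / (2 * C)) ^ k * ∫ y in closedBall c r, μ y) := by gcongr
      _ = _ := by rw [pow_succ]; ring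

theorem osc_bound {n : ℕ} (hn : 1 ≤ n) {μ : (Fin n → ℝ) → ℝ} {C : ℝ} (h : A1c μ C) {β : ℝ}
    (hβ : 0 < β) {b : (Fin n → ℝ) → ℝ} (hb : MemLip β μ b) :
    ∃ K, 0 ≤ K ∧ ∀ᵐ x, ∀ c r, 0 < r → x ∈ closedBall c r →
      |b x - cubeAvg (closedBall c r) b| ≤
        K * μ x * (∫ y in closedBall c r, μ y) ^ (β / n) := by
  obtain ⟨hbl, L0, hL0⟩ := hb
  set L := max L0 0 with hL
  have hLip : ∀ c r, 0 < r → ∫ y in closedBall c r, |b y - cubeAvg (closedBall c r) b| ≤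
      L * ((∫ y in closedBall c r, μ y) * (∫ y in closedBall c r, μ y) ^ (β / n)) := by
    intro c r hr
    have h1 := hL0 ⟨closedBall c r, (isCube_iff _).2 ⟨c, r, hr, rfl⟩, rfl⟩
    have hm := h.mpos c r hr
    rw [Real.rpow_neg hm.le, ← mul_inv, inv_mul_eq_div, div_le_iff₀ (by positivity)] at h1
    refine h1.trans ?_
    rw [mul_comm (_ ^ (β / n))]
    gcongr
    exact le_max_left _ _
  have hL0' : 0 ≤ L := le_max_right _ _
  have hC := h.one
  set θ := 1 - 1 / (2 * C) with hθ
  have hθ0 : 0 ≤ θ := by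
    rw [hθ, sub_nonneg, div_le_one (by positivity)]; linarith
  have hθ1 : θ < 1 := by
    have : 0 < 1 / (2 * C) := by positivity
    linarith
  have hn' : 0 < (n : ℝ) := by exact_mod_cast hn
  set η := θ ^ (β / n) with hη
  have hη1 : η < 1 := Real.rpow_lt_one hθ0 hθ1 (by positivity)
  have hη0 : 0 ≤ η := by positivity
  have hη2 : 0 < 1 - η := by linarith
  refine ⟨2 ^ n * L * C / (1 - η), by positivity, ?_⟩
  filter_upwards [shr_tendsto hbl, h.pt] with x hx hA c r hr hxc
  have hm := h.mpos c r hr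
  have hμx := h.nn x
  set K0 := 2 ^ n * L * C * μ x * (∫ y in closedBall c r, μ y) ^ (β / n) with hK0
  have hstep : ∀ k : ℕ, dist (cubeAvg (closedBall (shr x c k) ((1/2 : ℝ) ^ k * r)) b)
      (cubeAvg (closedBall (shr x c (k+1)) ((1/2 : ℝ) ^ (k+1) * r)) b) ≤ K0 * η ^ k := by
    intro k
    have hr0 : 0 < (1/2 : ℝ) ^ k * r := by positivity
    have hr1 : 0 < (1/2 : ℝ) ^ (k+1) * r := by positivity
    have hdec := h.decay hn hr hxc k
    have hA' := hA _ _ hr0 (mem_shr hxc k)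
    have hLk := hLip (shr x c k) _ hr0
    have hmk := h.mpos (shr x c k) _ hr0
    have hsub := shr_sub hxc k
    have hitg := io hbl (shr x c k) ((1/2 : ℝ) ^ k * r)
    have hvol : (volume (closedBall (shr x c k) ((1/2 : ℝ) ^ k * r))).toReal =
        2 ^ n * (volume (closedBall (shr x c (k+1)) ((1/2 : ℝ) ^ (k+1) * r))).toReal := by
      rw [volR _ _ hr0, volR _ _ hr1, ← mul_pow, pow_succ]
      congr 1; ring
    have hv1 := volpos (shr x c (k+1)) _ hr1
    set Q := closedBall (shr x c k) ((1/2 : ℝ) ^ k * r)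
    set Q1 := closedBall (shr x c (k+1)) ((1/2 : ℝ) ^ (k+1) * r)
    set B := cubeAvg Q b
    have hcst : ∀ S : Set (Fin n → ℝ), S ⊆ Q → IntegrableOn (fun _ => B) S := fun S hS =>
      integrableOn_const (ne_top_of_le_ne_top measure_closedBall_lt_top.ne (measure_mono hS))
    have h1 : cubeAvg Q1 b - B = (volume Q1).toReal⁻¹ * ∫ y in Q1, (b y - B) := by
      rw [integral_sub (hitg.mono_set hsub) (hcst _ hsub), setIntegral_const, cubeAvg, smul_eq_mul,
        Measure.real]
      field_simp
    have h2 : |∫ y in Q1, (b y - B)| ≤ ∫ y in Q, |b y - B| := by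
      refine (abs_integral_le_integral_abs).trans ?_
      exact setIntegral_mono_set (hitg.sub (hcst _ subset_rfl)).abs (ae_of_all _ fun _ => abs_nonneg _)
        hsub.eventuallyLE
    rw [dist_comm, Real.dist_eq, h1, abs_mul, abs_of_nonneg (by positivity), inv_mul_eq_div,
      div_le_iff₀ hv1]
    calc |∫ y in Q1, (b y - B)| ≤ _ := h2
      _ ≤ _ := hLk
      _ ≤ L * ((C * μ x * (volume Q).toReal) * (θ ^ k * ∫ y in closedBall c r, μ y) ^ (β / n)) := by
        gcongr
      _ = K0 * η ^ k * (volume Q1).toReal := by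
        rw [Real.mul_rpow (by positivity) hm.le, ← Real.rpow_natCast, ← Real.rpow_mul hθ0,
          mul_comm (k : ℝ), Real.rpow_mul hθ0, Real.rpow_natCast, hvol, hK0]
        ring
  have := dist_le_of_le_geometric_of_tendsto₀ η K0 hη1 hstep (hx c r hr hxc)
  rw [shr_zero, pow_zero, one_mul, dist_comm, Real.dist_eq] at this
  refine this.trans (le_of_eq ?_)
  rw [hK0]; ring

theorem morrey_li {n : ℕ} {p κ : ℝ} {μ f : (Fin n → ℝ) → ℝ} (hf : MemMorrey p κ μ f) :
    LocallyIntegrable (fun x => |f x| ^ p * μ x) := by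
  rw [locallyIntegrable_iff]
  intro k hk
  obtain ⟨r, hr⟩ := hk.isBounded.subset_closedBall 0
  have := hf.1 (closedBall 0 (max r 1)) ((isCube_iff _).2 ⟨0, _, by positivity, rfl⟩)
  exact this.mono_set (hr.trans (closedBall_subset_closedBall (le_max_left _ _)))

theorem morrey_aem {n : ℕ} {p κ : ℝ} (hp : 1 < p) {μ f : (Fin n → ℝ) → ℝ} {C : ℝ} (h : A1c μ C)
    (hf : MemMorrey p κ μ f) : AEMeasurable (fun x => |f x|) volume := by
  have h1 := (morrey_li hf).aestronglyMeasurable.aemeasurable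
  have h2 := h.li.aestronglyMeasurable.aemeasurable
  refine ((h1.div h2).pow_const (1 / p)).congr ?_
  filter_upwards [h.pos] with x hx
  simp only [Pi.div_apply]
  rw [mul_div_cancel_right₀ _ hx.ne', ← Real.rpow_mul (abs_nonneg _), mul_one_div_cancel (by linarith),
    Real.rpow_one]

theorem morrey_int {n : ℕ} {p κ : ℝ} (hp : 1 < p) {μ f : (Fin n → ℝ) → ℝ} {C : ℝ} (h : A1c μ C)
    (hf : MemMorrey p κ μ f) (c : Fin n → ℝ) (r : ℝ) :
    IntegrableOn (fun x => |f x| * μ x) (closedBall c r) := by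
  have h1 := io (morrey_li hf) c r
  have h2 := io h.li c r
  refine (h1.add h2).mono' (((morrey_aem hp h hf).mul
    h.li.aestronglyMeasurable.aemeasurable).aestronglyMeasurable.restrict) (ae_of_all _ fun x => ?_)
  have hx := h.nn x
  simp only [Pi.add_apply, Real.norm_eq_abs]
  rw [abs_of_nonneg (by positivity)]
  have : |f x| ≤ |f x| ^ p + 1 := by
    rcases le_total (|f x|) 1 with h1 | h1
    · have : 0 ≤ |f x| ^ p := by positivity
      linarith
    · have := Real.self_le_rpow_of_one_le h1 hp.le
      linarith
  nlinarith

theorem avg_le {n : ℕ} {μ f : (Fin n → ℝ) → ℝ} {C : ℝ} (h : A1c μ C)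
    (hfm : AEMeasurable (fun x => |f x|) volume) (c : Fin n → ℝ) (r : ℝ) (hr : 0 < r)
    (hi : IntegrableOn (fun x => |f x| * μ x) (closedBall c r)) :
    IntegrableOn (fun x => |f x|) (closedBall c r) ∧
    (volume (closedBall c r)).toReal⁻¹ * ∫ y in closedBall c r, |f y| ≤
      C * ((∫ y in closedBall c r, μ y)⁻¹ * ∫ y in closedBall c r, |f y| * μ y) := by
  have hm := h.mpos c r hr
  have hv := volpos c r hr
  set m := ∫ y in closedBall c r, μ y
  set V := (volume (closedBall c r)).toReal
  have hae : ∀ᵐ y ∂(volume.restrict (closedBall c r)), |f y| ≤ C * V * m⁻¹ * (|f y| * μ y) := by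
    rw [ae_restrict_iff' measurableSet_closedBall]
    filter_upwards [h.pt] with y hy hyc
    have := hy c r hr hyc
    have h1 : 1 ≤ C * V * m⁻¹ * μ y := by
      rw [show C * V * m⁻¹ * μ y = (C * μ y * V) / m by ring, le_div_iff₀ hm]
      simpa using this
    nlinarith [abs_nonneg (f y)]
  have hitg : IntegrableOn (fun x => |f x|) (closedBall c r) := by
    refine (hi.const_mul (C * V * m⁻¹)).mono' hfm.aestronglyMeasurable.restrict ?_
    filter_upwards [hae] with y hy
    simpa using hy
  refine ⟨hitg, ?_⟩
  have := setIntegral_mono_ae_restrict hitg (hi.const_mul (C * V * m⁻¹)) hae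
  rw [integral_const_mul] at this
  rw [inv_mul_eq_div, div_le_iff₀ hv]
  linarith

theorem comm_avg {n : ℕ} {μ f b : (Fin n → ℝ) → ℝ} {C : ℝ} (h : A1c μ C) (hbl : LocallyIntegrable b)
    {β K : ℝ} (hK : 0 ≤ K)
    (hosc : ∀ᵐ x, ∀ c r, 0 < r → x ∈ closedBall c r →
      |b x - cubeAvg (closedBall c r) b| ≤ K * μ x * (∫ y in closedBall c r, μ y) ^ (β / n))
    (hfm : AEMeasurable (fun x => |f x|) volume)
    (hi : ∀ c r, IntegrableOn (fun x => |f x| * μ x) (closedBall c r)) :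
    ∀ᵐ x, ∀ c r, 0 < r → x ∈ closedBall c r →
      |(|b x| * ((volume (closedBall c r)).toReal⁻¹ * ∫ y in closedBall c r, |f y|)) -
        ((volume (closedBall c r)).toReal⁻¹ * ∫ y in closedBall c r, |b y * f y|)| ≤
      2 * K * C * μ x * ((∫ y in closedBall c r, μ y) ^ (β / n) *
        ((∫ y in closedBall c r, μ y)⁻¹ * ∫ y in closedBall c r, |f y| * μ y)) := by
  filter_upwards [hosc, h.pt] with x hx hA c r hr hxc
  obtain ⟨hitg, havg⟩ := avg_le h hfm c r hr (hi c r)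
  have hm := h.mpos c r hr
  have hv := volpos c r hr
  have hA := hA c r hr hxc
  have hx := hx c r hr hxc
  have hiQ := hi c r
  have hosc' : ∀ᵐ y ∂(volume.restrict (closedBall c r)),
      |b y - cubeAvg (closedBall c r) b| ≤ K * μ y * (∫ y in closedBall c r, μ y) ^ (β / n) := by
    rw [ae_restrict_iff' measurableSet_closedBall]
    filter_upwards [hosc] with y hy hyc using hy c r hr hyc
  set Q := closedBall c r
  set m := ∫ y in Q, μ y
  set V := (volume Q).toReal
  set B := cubeAvg Q b
  have hμx := h.nn x
  have hC := h.one
  have hJ : 0 ≤ ∫ y in Q, |f y| * μ y :=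
    integral_nonneg fun y => mul_nonneg (abs_nonneg _) (h.nn y)
  have hbf : IntegrableOn (fun y => |b y * f y|) Q := by
    have : (fun y => |b y * f y|) = fun y => |b y| * |f y| := by ext y; exact abs_mul _ _
    rw [this]
    refine ((hitg.const_mul |B|).add (hiQ.const_mul (K * m ^ (β / n)))).mono'
      ((hbl.aestronglyMeasurable.aemeasurable.abs.mul hfm).aestronglyMeasurable.restrict) ?_
    filter_upwards [hosc'] with y hy
    simp only [Pi.add_apply, norm_mul, Real.norm_eq_abs, abs_abs]
    have h1 : |b y| ≤ |B| + K * μ y * m ^ (β / n) := by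
      have := abs_sub_abs_le_abs_sub (b y) B
      linarith
    calc |b y| * |f y| ≤ (|B| + K * μ y * m ^ (β / n)) * |f y| := by gcongr
      _ = _ := by ring
  have hdiff : |(∫ y in Q, |b x| * |f y|) - (∫ y in Q, |b y * f y|)| ≤
      K * μ x * m ^ (β / n) * (∫ y in Q, |f y|) + K * m ^ (β / n) * ∫ y in Q, |f y| * μ y := by
    rw [← integral_sub (hitg.const_mul _) hbf, ← integral_const_mul, ← integral_const_mul,
      ← integral_add (hitg.const_mul _) (hiQ.const_mul _)]
    refine abs_integral_le_integral_abs.trans ?_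
    refine setIntegral_mono_ae_restrict ((hitg.const_mul _).sub hbf).abs
      ((hitg.const_mul _).add (hiQ.const_mul _)) ?_
    filter_upwards [hosc'] with y hy
    rw [abs_mul (b y), ← sub_mul, abs_mul, abs_abs]
    have h1 : |(|b x| - |b y|)| ≤ K * μ x * m ^ (β / n) + K * μ y * m ^ (β / n) := by
      have h2 := abs_abs_sub_abs_le (b x) (b y)
      have h3 := abs_sub_le (b x) B (b y)
      rw [abs_sub_comm B] at h3
      linarith
    calc |(|b x| - |b y|)| * |f y| ≤ (K * μ x * m ^ (β / n) + K * μ y * m ^ (β / n)) * |f y| := by gcongr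
      _ = _ := by ring
  rw [integral_const_mul] at hdiff
  have hVinv : V⁻¹ ≤ C * μ x * m⁻¹ := by
    rw [inv_le_iff_one_le_mul₀ hv, show C * μ x * m⁻¹ * V = (C * μ x * V) / m by ring, le_div_iff₀ hm]
    simpa using hA
  rw [show |b x| * (V⁻¹ * ∫ y in Q, |f y|) - V⁻¹ * ∫ y in Q, |b y * f y| =
    V⁻¹ * (|b x| * (∫ y in Q, |f y|) - ∫ y in Q, |b y * f y|) by ring, abs_mul,
    abs_of_pos (inv_pos.2 hv)]
  calc _ ≤ V⁻¹ * (K * μ x * m ^ (β / n) * (∫ y in Q, |f y|) + K * m ^ (β / n) * ∫ y in Q, |f y| * μ y) := by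
        gcongr
    _ = K * μ x * m ^ (β / n) * (V⁻¹ * ∫ y in Q, |f y|) + V⁻¹ * (K * m ^ (β / n) * ∫ y in Q, |f y| * μ y) := by
        ring
    _ ≤ K * μ x * m ^ (β / n) * (C * (m⁻¹ * ∫ y in Q, |f y| * μ y)) +
        (C * μ x * m⁻¹) * (K * m ^ (β / n) * ∫ y in Q, |f y| * μ y) := by
        gcongr
    _ = _ := by ring

theorem comm_le {n : ℕ} {f b : (Fin n → ℝ) → ℝ} (x : Fin n → ℝ) (hb : 0 ≤ b x) (B : ℝ)
    (hbd : BddAbove (hlMaxSet f x))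
    (h : ∀ c r, 0 < r → x ∈ closedBall c r →
      |(|b x| * ((volume (closedBall c r)).toReal⁻¹ * ∫ y in closedBall c r, |f y|)) -
        ((volume (closedBall c r)).toReal⁻¹ * ∫ y in closedBall c r, |b y * f y|)| ≤ B) :
    |commM b f x| ≤ B := by
  rw [abs_of_nonneg hb] at h
  have hne : ∀ g, (hlMaxSet g x).Nonempty := fun g =>
    ⟨_, closedBall x 1, (isCube_iff _).2 ⟨x, 1, one_pos, rfl⟩, mem_closedBall_self (by norm_num), rfl⟩
  have h1 : ∀ s ∈ hlMaxSet (fun y => b y * f y) x, s ≤ b x * hlMax f x + B := by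
    rintro s ⟨Q, hQ, hxQ, rfl⟩
    obtain ⟨c, r, hr, rfl⟩ := (isCube_iff _).1 hQ
    have h2 := (abs_le.1 (h c r hr hxQ)).1
    have h3 := le_csSup hbd ⟨_, hQ, hxQ, rfl⟩
    have := mul_le_mul_of_nonneg_left h3 hb
    unfold hlMax
    linarith
  have h4 : hlMax (fun y => b y * f y) x ≤ b x * hlMax f x + B := csSup_le (hne _) h1
  have hB : 0 ≤ B := (abs_nonneg _).trans (h x 1 one_pos (mem_closedBall_self (by norm_num)))
  have h5 : b x * hlMax f x ≤ hlMax (fun y => b y * f y) x + B := by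
    rcases hb.eq_or_lt with h0 | h0
    · rw [← h0, zero_mul]
      have : 0 ≤ hlMax (fun y => b y * f y) x := by
        apply Real.sSup_nonneg
        rintro s ⟨Q, hQ, hxQ, rfl⟩
        exact mul_nonneg (by positivity) (integral_nonneg fun _ => abs_nonneg _)
      linarith
    · rw [← le_div_iff₀' h0]
      apply csSup_le (hne f)
      rintro s ⟨Q, hQ, hxQ, rfl⟩
      obtain ⟨c, r, hr, rfl⟩ := (isCube_iff _).1 hQ
      rw [le_div_iff₀' h0]
      have h2 := (abs_le.1 (h c r hr hxQ)).2
      have h3 := le_csSup ⟨_, h1⟩ ⟨_, hQ, hxQ, rfl⟩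
      unfold hlMax
      linarith
  unfold commM
  rw [abs_le]
  constructor <;> linarith

/-- The measure `μ dx`. -/
def nuM {n : ℕ} (μ : (Fin n → ℝ) → ℝ) : Measure (Fin n → ℝ) :=
  volume.withDensity fun x => ENNReal.ofReal (μ x)

theorem nuM_lint {n : ℕ} {μ g : (Fin n → ℝ) → ℝ} {C : ℝ} (h : A1c μ C)
    (hg : AEMeasurable g volume) (hg0 : ∀ x, 0 ≤ g x) (S : Set (Fin n → ℝ)) (hS : MeasurableSet S)
    (hi : IntegrableOn (fun x => g x * μ x) S) :
    ∫⁻ x in S, ENNReal.ofReal (g x) ∂(nuM μ) = ENNReal.ofReal (∫ x in S, g x * μ x) := by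
  have hμ := h.li.aestronglyMeasurable.aemeasurable
  rw [nuM, restrict_withDensity hS, lintegral_withDensity_eq_lintegral_mul₀
    hμ.ennreal_ofReal.restrict hg.ennreal_ofReal.restrict,
    ofReal_integral_eq_lintegral_ofReal hi (ae_of_all _ fun x => mul_nonneg (hg0 x) (h.nn x))]
  apply lintegral_congr
  intro x
  rw [Pi.mul_apply, mul_comm, ENNReal.ofReal_mul (hg0 x)]

theorem nuM_apply {n : ℕ} {μ : (Fin n → ℝ) → ℝ} {C : ℝ} (h : A1c μ C) (c : Fin n → ℝ) (r : ℝ) :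
    nuM μ (closedBall c r) = ENNReal.ofReal (∫ x in closedBall c r, μ x) := by
  have := nuM_lint h (g := fun _ => 1) aemeasurable_const (fun _ => zero_le_one) (closedBall c r)
    measurableSet_closedBall (by simpa using io h.li c r)
  simpa using this

theorem A1c.dbl {n : ℕ} {μ : (Fin n → ℝ) → ℝ} {C : ℝ} (h : A1c μ C) (c : Fin n → ℝ) (r : ℝ)
    (hr : 0 < r) : ∫ x in closedBall c (4 * r), μ x ≤ C * 4 ^ n * ∫ x in closedBall c r, μ x := by
  have h1 := h.set c (4 * r) (by positivity) (closedBall c r) measurableSet_closedBall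
    (closedBall_subset_closedBall (by linarith))
  rw [volR c r hr, volR c (4 * r) (by positivity), show 2 * (4 * r) = 4 * (2 * r) by ring,
    mul_pow (4:ℝ) (2 * r)] at h1
  have : 0 < (2 * r) ^ n := by positivity
  refine le_of_mul_le_mul_right ?_ this
  linarith

theorem nuM_good {n : ℕ} {μ : (Fin n → ℝ) → ℝ} {C : ℝ} (h : A1c μ C) :
    GoodM (nuM μ) (ENNReal.ofReal (C * 4 ^ n)) where
  pos c r hr := by
    rw [nuM_apply h]
    simpa using h.mpos c r hr
  fin c r := by rw [nuM_apply h]; finiteness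
  Dfin := by finiteness
  dbl c r hr := by
    have := h.one
    rw [nuM_apply h, nuM_apply h, ← ENNReal.ofReal_mul (by positivity)]
    exact ENNReal.ofReal_le_ofReal (h.dbl c r hr)

theorem mmono {n : ℕ} {μ : (Fin n → ℝ) → ℝ} {C : ℝ} (h : A1c μ C) {c c' : Fin n → ℝ} {r r' : ℝ}
    (hs : closedBall c r ⊆ closedBall c' r') :
    ∫ x in closedBall c r, μ x ≤ ∫ x in closedBall c' r', μ x :=
  setIntegral_mono_set (io h.li c' r') (ae_of_all _ h.nn) hs.eventuallyLE

theorem holderR {n : ℕ} {p κ : ℝ} (hp : 1 < p) {μ f : (Fin n → ℝ) → ℝ} {C : ℝ} (h : A1c μ C)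
    (hf : MemMorrey p κ μ f) (c : Fin n → ℝ) (r : ℝ) (hr : 0 < r) :
    (∫ x in closedBall c r, μ x)⁻¹ * ∫ x in closedBall c r, |f x| * μ x ≤
      (∫ x in closedBall c r, μ x) ^ (-(1/p)) * (∫ x in closedBall c r, |f x| ^ p * μ x) ^ (1/p) := by
  have hp0 : 0 < p := by linarith
  have hm := h.mpos c r hr
  have hfm := morrey_aem hp h hf
  have hfp : AEMeasurable (fun x => |f x| ^ p) volume := hfm.pow_const p
  have hac : nuM μ ≪ volume := withDensity_absolutelyContinuous _ _
  have e1 := nuM_lint h hfm (fun _ => abs_nonneg _) _ measurableSet_closedBall (morrey_int hp h hf c r)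
  have e2 := nuM_lint h hfp (fun _ => by positivity) _ measurableSet_closedBall
    (io (morrey_li hf) c r)
  have hP : 0 ≤ ∫ x in closedBall c r, |f x| ^ p * μ x :=
    integral_nonneg fun x => mul_nonneg (by positivity) (h.nn x)
  have hq := Real.HolderConjugate.conjExponent hp
  have := ENNReal.lintegral_mul_le_Lp_mul_Lq ((nuM μ).restrict (closedBall c r)) hq
    (f := fun x => ENNReal.ofReal |f x|) (g := fun _ => 1)
    (hfm.mono_ac hac).ennreal_ofReal.restrict aemeasurable_const
  have e3 : ∀ x, ENNReal.ofReal |f x| ^ p = ENNReal.ofReal (|f x| ^ p) := fun x =>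
    ENNReal.ofReal_rpow_of_nonneg (abs_nonneg _) hp0.le
  simp only [Pi.mul_apply, mul_one, ENNReal.one_rpow, lintegral_const, one_mul, e3,
    Measure.restrict_apply MeasurableSet.univ, univ_inter] at this
  rw [e1, e2, nuM_apply h, ENNReal.ofReal_rpow_of_nonneg hP (by positivity),
    ENNReal.ofReal_rpow_of_pos hm, ← ENNReal.ofReal_mul (by positivity),
    ENNReal.ofReal_le_ofReal_iff (by positivity)] at this
  have e4 : 1 / p.conjExponent = 1 + -(1/p) := by
    have := hq.inv_add_inv_eq_one
    simp only [one_div]; linarith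
  rw [e4, Real.rpow_add hm, Real.rpow_one] at this
  rw [inv_mul_le_iff₀ hm]
  linarith

theorem small_bound {n : ℕ} {p κ : ℝ} (hp : 1 < p) {μ f : (Fin n → ℝ) → ℝ} {C : ℝ} (h : A1c μ C)
    (hf : MemMorrey p κ μ f) (S : Set (Fin n → ℝ)) (x c : Fin n → ℝ) (r : ℝ) (hr : 0 < r)
    (hx : x ∈ closedBall c r) (hsub : closedBall c r ⊆ S)
    (hN : maxN (nuM μ) (fun y => ENNReal.ofReal (S.indicator (fun z => |f z|) y)) x ≠ ∞) :
    (∫ x in closedBall c r, μ x)⁻¹ * ∫ x in closedBall c r, |f x| * μ x ≤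
      C * 4 ^ n *
        (maxN (nuM μ) (fun y => ENNReal.ofReal (S.indicator (fun z => |f z|) y)) x).toReal := by
  have hC := h.one
  have hm := h.mpos c r hr
  have hJ : 0 ≤ ∫ y in closedBall c r, |f y| * μ y :=
    integral_nonneg fun y => mul_nonneg (abs_nonneg _) (h.nn y)
  have hD : 0 < C * 4 ^ n := by positivity
  have hG := nuM_good h
  have e1 := nuM_lint h (morrey_aem hp h hf) (fun _ => abs_nonneg _) _ measurableSet_closedBall
    (morrey_int hp h hf c r)
  rw [← ENNReal.ofReal_le_ofReal_iff (by positivity), ENNReal.ofReal_mul (by positivity),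
    ENNReal.ofReal_mul (by positivity), ENNReal.ofReal_toReal hN, ← e1, ENNReal.ofReal_inv_of_pos hm,
    ← nuM_apply h]
  set ν := nuM μ
  set D := ENNReal.ofReal (C * 4 ^ n)
  set hh : (Fin n → ℝ) → ℝ≥0∞ := fun y => ENNReal.ofReal (S.indicator (fun z => |f z|) y) with hhh
  have hD0 : D ≠ 0 := by simpa [D] using hD
  have h1 : ∫⁻ y in closedBall c r, ENNReal.ofReal |f y| ∂ν ≤ ∫⁻ y in closedBall c (2 * r), hh y ∂ν := by
    calc _ = ∫⁻ y in closedBall c r, hh y ∂ν := by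
          apply setLIntegral_congr_fun measurableSet_closedBall
          intro y hy
          simp only [hhh, indicator_of_mem (hsub hy)]
      _ ≤ _ := lintegral_mono_set (closedBall_subset_closedBall (by linarith))
  have h2 : (ν (closedBall c r))⁻¹ ≤ D * (ν (closedBall c (2 * r)))⁻¹ := by
    have h3 : ν (closedBall c (2 * r)) ≤ D * ν (closedBall c r) :=
      (measure_mono (closedBall_subset_closedBall (by linarith))).trans (hG.dbl c r hr)
    calc (ν (closedBall c r))⁻¹ = D * (D * ν (closedBall c r))⁻¹ := by
          rw [ENNReal.mul_inv (Or.inl hD0) (Or.inl hG.Dfin), ← mul_assoc,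
            ENNReal.mul_inv_cancel hD0 hG.Dfin, one_mul]
      _ ≤ _ := by gcongr
  calc _ ≤ D * (ν (closedBall c (2 * r)))⁻¹ * ∫⁻ y in closedBall c (2 * r), hh y ∂ν := by gcongr
    _ = D * ((ν (closedBall c (2 * r)))⁻¹ * ∫⁻ y in closedBall c (2 * r), hh y ∂ν) := by ring
    _ ≤ D * maxN ν hh x := by
      gcongr
      unfold maxN
      refine le_iSup_of_le c (le_iSup_of_le (2 * r) (le_iSup_of_le (by positivity)
        (le_iSup_of_le ?_ le_rfl)))
      exact closedBall_subset_ball (by linarith) hx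

theorem ptG {n : ℕ} {p q κ a A : ℝ} (hp : 1 < p) (ha : 0 < a) (hq : 1 / q = 1 / p - a)
    (hq0 : 0 < q) (hκ : κ < p / q) (hA : 0 ≤ A)
    {μ f : (Fin n → ℝ) → ℝ} {C : ℝ} (h : A1c μ C) (hf : MemMorrey p κ μ f)
    (hP : ∀ c r, 0 < r → ∫ x in closedBall c r, |f x| ^ p * μ x ≤
      A ^ p * (∫ x in closedBall c r, μ x) ^ κ)
    (c0 : Fin n → ℝ) (r0 : ℝ) (hr0 : 0 < r0) (x : Fin n → ℝ) (hx0 : x ∈ closedBall c0 r0)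
    (hN : maxN (nuM μ) (fun y => ENNReal.ofReal
      ((closedBall c0 (4 * r0)).indicator (fun z => |f z|) y)) x ≠ ∞)
    (c : Fin n → ℝ) (r : ℝ) (hr : 0 < r) (hx : x ∈ closedBall c r) :
    (∫ x in closedBall c r, μ x)⁻¹ * ∫ x in closedBall c r, |f x| * μ x ≤
      C * 4 ^ n * (maxN (nuM μ) (fun y => ENNReal.ofReal
        ((closedBall c0 (4 * r0)).indicator (fun z => |f z|) y)) x).toReal +
        A * ((∫ x in closedBall c0 r0, μ x) / (C * 4 ^ n)) ^ (-((1 - κ) / p)) ∧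
    (∫ x in closedBall c r, μ x) ^ a *
      ((∫ x in closedBall c r, μ x)⁻¹ * ∫ x in closedBall c r, |f x| * μ x) ≤
      (C * 4 ^ n * (maxN (nuM μ) (fun y => ENNReal.ofReal
        ((closedBall c0 (4 * r0)).indicator (fun z => |f z|) y)) x).toReal) ^ (p / q) *
        ((∫ x in closedBall c0 (4 * r0), |f x| ^ p * μ x) ^ (1 / p)) ^ (1 - p / q) +
        A * ((∫ x in closedBall c0 r0, μ x) / (C * 4 ^ n)) ^ (-(1 / q - κ / p)) := by
  have hp0 : 0 < p := by linarith
  have hC := h.one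
  have hm := h.mpos c r hr
  have hm0 := h.mpos c0 r0 hr0
  have hD : 0 < C * 4 ^ n := by positivity
  have hJ : 0 ≤ ∫ y in closedBall c r, |f y| * μ y :=
    integral_nonneg fun y => mul_nonneg (abs_nonneg _) (h.nn y)
  have hPP : ∀ c r, 0 ≤ ∫ x in closedBall c r, |f x| ^ p * μ x := fun c r =>
    integral_nonneg fun x => mul_nonneg (by positivity) (h.nn x)
  have hH := holderR hp h hf c r hr
  have hpq : p / q = 1 - a * p := by
    have : p / q = p * (1 / q) := by ring
    rw [this, hq]; field_simp
  have hpq0 : 0 < p / q := by positivity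
  have hpq1 : p / q < 1 := by rw [hpq]; nlinarith
  set Y := (maxN (nuM μ) (fun y => ENNReal.ofReal
        ((closedBall c0 (4 * r0)).indicator (fun z => |f z|) y)) x).toReal with hY
  have hY0 : 0 ≤ Y := ENNReal.toReal_nonneg
  have hP4 := hPP c0 (4 * r0)
  have hPc := hP c r hr
  have hX0 : 0 ≤ (∫ x in closedBall c r, μ x)⁻¹ * ∫ x in closedBall c r, |f x| * μ x := by positivity
  rcases lt_or_ge r r0 with hrr | hrr
  · have hsub : closedBall c r ⊆ closedBall c0 (4 * r0) := by
      apply closedBall_subset_closedBall'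
      have h1 : dist x c ≤ r := hx
      have h2 : dist x c0 ≤ r0 := hx0
      have := dist_triangle_left c c0 x
      linarith
    have hs := small_bound hp h hf _ x c r hr hx hsub hN
    rw [← hY] at hs
    have hle : ∫ x in closedBall c r, |f x| ^ p * μ x ≤ ∫ x in closedBall c0 (4 * r0), |f x| ^ p * μ x :=
      setIntegral_mono_set (io (morrey_li hf) _ _)
        (ae_of_all _ fun x => mul_nonneg (by positivity) (h.nn x)) hsub.eventuallyLE
    refine ⟨hs.trans (le_add_of_nonneg_right (by positivity)), ?_⟩
    refine le_trans ?_ (le_add_of_nonneg_right (by positivity))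
    have hPc0 := hPP c r
    set m := ∫ x in closedBall c r, μ x
    set X := m⁻¹ * ∫ x in closedBall c r, |f x| * μ x
    set H := (∫ x in closedBall c0 (4 * r0), |f x| ^ p * μ x) ^ (1 / p)
    have hH' : X ≤ m ^ (-(1/p)) * H := by
      refine hH.trans ?_
      simp only [H]
      gcongr
    have hH0 : 0 ≤ H := by positivity
    calc m ^ a * X = m ^ a * (X ^ (p / q) * X ^ (1 - p / q)) := by
          rw [← Real.rpow_add_of_nonneg hX0 hpq0.le (by linarith)]
          simp
      _ ≤ m ^ a * ((C * 4 ^ n * Y) ^ (p / q) * (m ^ (-(1/p)) * H) ^ (1 - p / q)) := by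
          have : 0 ≤ 1 - p / q := by linarith
          gcongr
      _ = (m ^ a * m ^ (-(1/p) * (1 - p/q))) * ((C * 4 ^ n * Y) ^ (p / q) * H ^ (1 - p / q)) := by
          rw [Real.mul_rpow (by positivity) hH0, ← Real.rpow_mul hm.le]
          ring
      _ = _ := by
          rw [← Real.rpow_add hm]
          have : a + -(1/p) * (1 - p/q) = 0 := by rw [hpq]; field_simp; ring
          rw [this, Real.rpow_zero, one_mul]
  · have hsub : closedBall c0 r0 ⊆ closedBall c (4 * r) := by
      apply closedBall_subset_closedBall'
      have h1 : dist x c ≤ r := hx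
      have h2 : dist x c0 ≤ r0 := hx0
      have := dist_triangle_left c0 c x
      linarith
    have hm1 : (∫ x in closedBall c0 r0, μ x) / (C * 4 ^ n) ≤ ∫ x in closedBall c r, μ x := by
      rw [div_le_iff₀ hD]
      have := (mmono h hsub).trans (h.dbl c r hr)
      linarith
    have hPc0 := hPP c r
    set m := ∫ x in closedBall c r, μ x
    set m0 := ∫ x in closedBall c0 r0, μ x
    set X := m⁻¹ * ∫ x in closedBall c r, |f x| * μ x
    have hX : X ≤ A * m ^ (-((1 - κ) / p)) := by
      calc X ≤ m ^ (-(1/p)) * (A ^ p * m ^ κ) ^ (1/p) := by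
            refine hH.trans ?_
            gcongr
        _ = A * (m ^ (-(1/p)) * m ^ (κ * (1/p))) := by
            rw [Real.mul_rpow (by positivity) (by positivity), ← Real.rpow_mul hA,
              ← Real.rpow_mul hm.le, mul_one_div_cancel hp0.ne', Real.rpow_one]
            ring
        _ = _ := by
            rw [← Real.rpow_add hm]
            congr 2
            field_simp
            ring
    have hDm : 0 < m0 / (C * 4 ^ n) := by positivity
    constructor
    · refine hX.trans ?_
      refine le_trans ?_ (le_add_of_nonneg_left (by positivity))
      gcongr A * ?_
      apply Real.rpow_le_rpow_of_nonpos hDm hm1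
      rw [neg_nonpos]
      apply div_nonneg _ hp0.le
      linarith
    · refine le_trans ?_ (le_add_of_nonneg_left (by positivity))
      calc m ^ a * X ≤ m ^ a * (A * m ^ (-((1 - κ) / p))) := by gcongr
        _ = A * (m ^ a * m ^ (-((1 - κ) / p))) := by ring
        _ = A * m ^ (-(1 / q - κ / p)) := by
            rw [← Real.rpow_add hm, hq]
            congr 2
            field_simp
            ring
        _ ≤ _ := by
            gcongr A * ?_
            apply Real.rpow_le_rpow_of_nonpos hDm hm1
            rw [neg_nonpos, sub_nonneg, div_le_div_iff₀ hp0 hq0]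
            rw [lt_div_iff₀ hq0] at hκ
            linarith

theorem rpow_add_le' {u v q : ℝ} (hu : 0 ≤ u) (hv : 0 ≤ v) (hq : 0 < q) :
    (u + v) ^ q ≤ 2 ^ q * (u ^ q + v ^ q) := by
  have hu' : 0 ≤ u ^ q := by positivity
  have hv' : 0 ≤ v ^ q := by positivity
  rcases le_total u v with h | h
  · calc (u + v) ^ q ≤ (2 * v) ^ q := by gcongr; linarith
      _ = 2 ^ q * v ^ q := Real.mul_rpow (by norm_num) hv
      _ ≤ _ := by gcongr; linarith
  · calc (u + v) ^ q ≤ (2 * u) ^ q := by gcongr; linarith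
      _ = 2 ^ q * u ^ q := Real.mul_rpow (by norm_num) hu
      _ ≤ _ := by gcongr; linarith

theorem cube_bound {n : ℕ} {p q κ a A K : ℝ} (hp : 1 < p) (ha : 0 < a) (hq : 1 / q = 1 / p - a)
    (hq0 : 0 < q) (hκ0 : 0 < κ) (hκ : κ < p / q) (hA : 0 ≤ A) (hK : 0 ≤ K)
    {μ f b : (Fin n → ℝ) → ℝ} {C : ℝ} (h : A1c μ C) (hf : MemMorrey p κ μ f)
    (hP : ∀ c r, 0 < r → ∫ x in closedBall c r, |f x| ^ p * μ x ≤
      A ^ p * (∫ x in closedBall c r, μ x) ^ κ)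
    (hb0 : ∀ᵐ x, 0 ≤ b x)
    (hcomm : ∀ᵐ x, ∀ c r, 0 < r → x ∈ closedBall c r →
      |(|b x| * ((volume (closedBall c r)).toReal⁻¹ * ∫ y in closedBall c r, |f y|)) -
        ((volume (closedBall c r)).toReal⁻¹ * ∫ y in closedBall c r, |b y * f y|)| ≤
      K * μ x * ((∫ y in closedBall c r, μ y) ^ a *
        ((∫ y in closedBall c r, μ y)⁻¹ * ∫ y in closedBall c r, |f y| * μ y)))
    (cp : ℝ≥0∞) (hcp : cp ≠ ∞)
    (hmax : ∀ g : (Fin n → ℝ) → ℝ, AEMeasurable g (nuM μ) → (∀ x, 0 ≤ g x) →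
      ∫⁻ x, maxN (nuM μ) (fun y => ENNReal.ofReal (g y)) x ^ p ∂(nuM μ) ≤
        cp * ∫⁻ x, ENNReal.ofReal (g x) ^ p ∂(nuM μ))
    (c0 : Fin n → ℝ) (r0 : ℝ) (hr0 : 0 < r0) :
    ∫ x in closedBall c0 r0, |commM b f x| ^ q * μ x ^ (1 - q) ≤
      (K ^ q * 2 ^ q * ((C * 4 ^ n) ^ p * cp.toReal * (C * 4 ^ n) ^ (κ * q / p) +
        (C * 4 ^ n) ^ (1 - κ * q / p))) *
        (A ^ q * (∫ x in closedBall c0 r0, μ x) ^ (κ * q / p)) := by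
  have hp0 : 0 < p := by linarith
  have hC := h.one
  have hm0 := h.mpos c0 r0 hr0
  have hD : 0 < C * 4 ^ n := by positivity
  have hpq : p / q = 1 - a * p := by
    have : p / q = p * (1 / q) := by ring
    rw [this, hq]; field_simp
  have hpq1 : p / q < 1 := by rw [hpq]; nlinarith
  have hqp : p < q := by rwa [div_lt_one hq0] at hpq1
  have hfm := morrey_aem hp h hf
  have hac : nuM μ ≪ volume := withDensity_absolutelyContinuous _ _
  set g : (Fin n → ℝ) → ℝ := (closedBall c0 (4 * r0)).indicator (fun z => |f z|) with hg
  have hg0 : ∀ x, 0 ≤ g x := fun x => indicator_nonneg (fun _ _ => abs_nonneg _) x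
  have hgm : AEMeasurable g (nuM μ) := (hfm.indicator measurableSet_closedBall).mono_ac hac
  set P := ∫ x in closedBall c0 (4 * r0), |f x| ^ p * μ x with hPdef
  have hP0 : 0 ≤ P := integral_nonneg fun x => mul_nonneg (by positivity) (h.nn x)
  set H := P ^ (1 / p) with hH
  have hH0 : 0 ≤ H := by positivity
  have hHp : H ^ p = P := by
    rw [hH, ← Real.rpow_mul hP0, one_div_mul_cancel hp0.ne', Real.rpow_one]
  have hgp : ∫⁻ x, ENNReal.ofReal (g x) ^ p ∂(nuM μ) = ENNReal.ofReal (H ^ p) := by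
    rw [hHp, hPdef, ← nuM_lint h (hfm.pow_const p) (fun _ => by positivity) _ measurableSet_closedBall
      (io (morrey_li hf) c0 (4 * r0)), ← lintegral_indicator measurableSet_closedBall]
    apply lintegral_congr
    intro x
    rw [ENNReal.ofReal_rpow_of_nonneg (hg0 x) hp0.le]
    by_cases hx : x ∈ closedBall c0 (4 * r0)
    · simp only [hg, indicator_of_mem hx]
    · simp only [hg, indicator_of_notMem hx]
      rw [Real.zero_rpow hp0.ne', ENNReal.ofReal_zero]
  set N := maxN (nuM μ) (fun y => ENNReal.ofReal (g y)) with hN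
  have hNm : Measurable N := maxN_measurable _ _
  have hNp : ∫⁻ x, N x ^ p ∂(nuM μ) ≤ ENNReal.ofReal (cp.toReal * H ^ p) := by
    rw [ENNReal.ofReal_mul ENNReal.toReal_nonneg, ENNReal.ofReal_toReal hcp, ← hgp]
    exact hmax g hgm hg0
  have hNfin : ∀ᵐ x, N x ≠ ∞ := by
    have h1 : ∀ᵐ x ∂(nuM μ), N x ^ p < ∞ :=
      ae_lt_top (hNm.pow_const p) (ne_top_of_le_ne_top ENNReal.ofReal_ne_top hNp)
    rw [nuM, ae_withDensity_iff' h.li.aestronglyMeasurable.aemeasurable.ennreal_ofReal] at h1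
    filter_upwards [h1, h.pos] with x hx hpos htop
    have := hx (by simpa using hpos)
    rw [htop, ENNReal.top_rpow_of_pos hp0] at this
    exact lt_irrefl _ this
  set m0 := ∫ x in closedBall c0 r0, μ x with hm0def
  set D := C * 4 ^ n with hDdef
  set Y : (Fin n → ℝ) → ℝ := fun x => (N x).toReal with hY
  have hY0 : ∀ x, 0 ≤ Y x := fun x => ENNReal.toReal_nonneg
  set k1 := K ^ q * 2 ^ q * (D ^ p * H ^ (q - p)) with hk1
  set k2 := K ^ q * 2 ^ q * (A ^ q * (m0 / D) ^ (-(1 - κ * q / p))) with hk2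
  have hk10 : 0 ≤ k1 := by positivity
  have hk20 : 0 ≤ k2 := by positivity
  -- the pointwise bound
  have hpt : ∀ᵐ x ∂(volume.restrict (closedBall c0 r0)),
      |commM b f x| ^ q * μ x ^ (1 - q) ≤ μ x * (k1 * Y x ^ p + k2) := by
    rw [ae_restrict_iff' measurableSet_closedBall]
    filter_upwards [hNfin, hb0, hcomm, h.pos] with x hxN hbx hcx hμx hx0
    have hG := ptG hp ha hq hq0 hκ hA h hf hP c0 r0 hr0 x hx0 hxN
    have hYx := hY0 x
    set G := (D * Y x) ^ (p / q) * H ^ (1 - p / q) + A * (m0 / D) ^ (-(1 / q - κ / p)) with hGdef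
    have hG0 : 0 ≤ G := by positivity
    have hbd : BddAbove (hlMaxSet f x) := by
      refine ⟨C * (D * Y x + A * (m0 / D) ^ (-((1 - κ) / p))), ?_⟩
      rintro s ⟨Q, hQ, hxQ, rfl⟩
      obtain ⟨c, r, hr, rfl⟩ := (isCube_iff _).1 hQ
      refine (avg_le h hfm c r hr (morrey_int hp h hf c r)).2.trans ?_
      gcongr
      exact (hG c r hr hxQ).1
    have hc : |commM b f x| ≤ K * μ x * G := by
      refine comm_le x hbx _ hbd fun c r hr hxc => (hcx c r hr hxc).trans ?_
      gcongr
      exact (hG c r hr hxc).2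
    have hGq : G ^ q ≤ 2 ^ q * (D ^ p * Y x ^ p * H ^ (q - p) +
        A ^ q * (m0 / D) ^ (-(1 - κ * q / p))) := by
      refine (rpow_add_le' (by positivity) (by positivity) hq0).trans (le_of_eq ?_)
      congr 2
      · rw [Real.mul_rpow (by positivity) (by positivity), ← Real.rpow_mul (by positivity),
          ← Real.rpow_mul hH0, div_mul_cancel₀ _ hq0.ne', sub_mul, div_mul_cancel₀ _ hq0.ne', one_mul,
          Real.mul_rpow hD.le hYx]
      · rw [Real.mul_rpow hA (by positivity), ← Real.rpow_mul (by positivity)]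
        congr 2
        field_simp
    calc |commM b f x| ^ q * μ x ^ (1 - q) ≤ (K * μ x * G) ^ q * μ x ^ (1 - q) := by gcongr
      _ = K ^ q * G ^ q * (μ x ^ q * μ x ^ (1 - q)) := by
        rw [Real.mul_rpow (by positivity) hG0, Real.mul_rpow hK hμx.le]; ring
      _ = K ^ q * G ^ q * μ x := by
        rw [← Real.rpow_add hμx]; simp
      _ ≤ K ^ q * (2 ^ q * (D ^ p * Y x ^ p * H ^ (q - p) +
        A ^ q * (m0 / D) ^ (-(1 - κ * q / p)))) * μ x := by gcongr
      _ = _ := by rw [hk1, hk2]; ring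
  have hfinal : k1 * (cp.toReal * H ^ p) + k2 * m0 ≤
      (K ^ q * 2 ^ q * (D ^ p * cp.toReal * D ^ (κ * q / p) + D ^ (1 - κ * q / p))) *
        (A ^ q * m0 ^ (κ * q / p)) := by
    have hcp0 : 0 ≤ cp.toReal := ENNReal.toReal_nonneg
    have hHq : H ^ (q - p) * H ^ p ≤ A ^ q * (D * m0) ^ (κ * q / p) := by
      rw [← Real.rpow_add_of_nonneg hH0 (by linarith) hp0.le, sub_add_cancel]
      have h1 : P ≤ A ^ p * (D * m0) ^ κ := by
        refine (hP c0 (4 * r0) (by positivity)).trans ?_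
        have := h.dbl c0 r0 hr0
        have := (h.mpos c0 (4 * r0) (by positivity)).le
        gcongr
      calc H ^ q = P ^ (q / p) := by
            rw [hH, ← Real.rpow_mul hP0]; congr 1; field_simp
        _ ≤ (A ^ p * (D * m0) ^ κ) ^ (q / p) := by gcongr
        _ = _ := by
            rw [Real.mul_rpow (by positivity) (by positivity), ← Real.rpow_mul hA,
              ← Real.rpow_mul (by positivity)]
            congr 2
            · field_simp
            · ring
    have h2 : (m0 / D) ^ (-(1 - κ * q / p)) * m0 = D ^ (1 - κ * q / p) * m0 ^ (κ * q / p) := by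
      rw [Real.rpow_neg (by positivity), Real.div_rpow hm0.le hD.le, inv_div, div_mul_eq_mul_div,
        mul_div_assoc]
      congr 1
      rw [div_eq_iff (by positivity), ← Real.rpow_add hm0]
      simp
    calc k1 * (cp.toReal * H ^ p) + k2 * m0 = K ^ q * 2 ^ q * (D ^ p * cp.toReal * (H ^ (q - p) * H ^ p)) +
          K ^ q * 2 ^ q * (A ^ q * ((m0 / D) ^ (-(1 - κ * q / p)) * m0)) := by rw [hk1, hk2]; ring
      _ ≤ K ^ q * 2 ^ q * (D ^ p * cp.toReal * (A ^ q * (D * m0) ^ (κ * q / p))) +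
          K ^ q * 2 ^ q * (A ^ q * ((m0 / D) ^ (-(1 - κ * q / p)) * m0)) := by gcongr
      _ = _ := by
        rw [h2, Real.mul_rpow hD.le hm0.le]; ring
  refine le_trans ?_ hfinal
  have hcp0 : 0 ≤ cp.toReal := ENNReal.toReal_nonneg
  by_cases hitg : IntegrableOn (fun x => |commM b f x| ^ q * μ x ^ (1 - q)) (closedBall c0 r0)
  swap
  · rw [integral_undef hitg]; positivity
  rw [← ENNReal.ofReal_le_ofReal_iff (by positivity), ofReal_integral_eq_lintegral_ofReal hitg
    (ae_of_all _ fun x => mul_nonneg (by positivity) (Real.rpow_nonneg (h.nn x) _))]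
  have hYm : Measurable Y := hNm.ennreal_toReal
  have hW : Measurable (fun x => ENNReal.ofReal (k1 * Y x ^ p + k2)) :=
    (((hYm.pow_const p).const_mul k1).add_const k2).ennreal_ofReal
  calc ∫⁻ x in closedBall c0 r0, ENNReal.ofReal (|commM b f x| ^ q * μ x ^ (1 - q))
      ≤ ∫⁻ x in closedBall c0 r0, ENNReal.ofReal (μ x) * ENNReal.ofReal (k1 * Y x ^ p + k2) := by
        apply lintegral_mono_ae
        filter_upwards [hpt] with x hx
        rw [← ENNReal.ofReal_mul (h.nn x)]
        exact ENNReal.ofReal_le_ofReal hx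
    _ = ∫⁻ x in closedBall c0 r0, ENNReal.ofReal (k1 * Y x ^ p + k2) ∂(nuM μ) := by
        rw [nuM, restrict_withDensity measurableSet_closedBall,
          lintegral_withDensity_eq_lintegral_mul₀
            h.li.aestronglyMeasurable.aemeasurable.ennreal_ofReal.restrict hW.aemeasurable]
        rfl
    _ ≤ ∫⁻ x in closedBall c0 r0, (ENNReal.ofReal k1 * N x ^ p + ENNReal.ofReal k2) ∂(nuM μ) := by
        apply lintegral_mono
        intro x
        have hYx := hY0 x
        dsimp only
        rw [ENNReal.ofReal_add (by positivity) hk20, ENNReal.ofReal_mul hk10,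
          ← ENNReal.ofReal_rpow_of_nonneg hYx hp0.le]
        gcongr
        exact ENNReal.ofReal_toReal_le
    _ = ENNReal.ofReal k1 * (∫⁻ x in closedBall c0 r0, N x ^ p ∂(nuM μ)) +
          ENNReal.ofReal k2 * nuM μ (closedBall c0 r0) := by
        rw [lintegral_add_right _ measurable_const, lintegral_const_mul _ (hNm.pow_const p),
          setLIntegral_const]
    _ ≤ ENNReal.ofReal k1 * ENNReal.ofReal (cp.toReal * H ^ p) + ENNReal.ofReal k2 * ENNReal.ofReal m0 := by
        rw [nuM_apply h]
        gcongr
        exact (setLIntegral_le_lintegral _ _).trans hNp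
    _ = _ := by
        rw [← ENNReal.ofReal_mul hk10, ← ENNReal.ofReal_mul hk20, ← ENNReal.ofReal_add (by positivity)
          (by positivity)]

theorem commM_bounded_aux
    (n : ℕ) (hn : 1 ≤ n) (μ : (Fin n → ℝ) → ℝ) (hμ : IsA1 μ)
    (β p q κ : ℝ) (hβ0 : 0 < β)
    (hp1 : 1 < p) (hpn : p < n / β)
    (hq : 1 / q = 1 / p - β / n) (hκ0 : 0 < κ) (hκ : κ < p / q)
    (b : (Fin n → ℝ) → ℝ) (hb : MemLip β μ b)
    (hb0 : ∀ᵐ x ∂(MeasureTheory.volume : Measure (Fin n → ℝ)), 0 ≤ b x) :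
    ∃ C > 0, ∀ f : (Fin n → ℝ) → ℝ, MemMorrey p κ μ f →
      morreyNorm2 q (κ * q / p) (fun x => μ x ^ (1 - q)) μ (commM b f) ≤
        C * morreyNorm p κ μ f := by
  have hp0 : 0 < p := by linarith
  have hn' : 0 < (n : ℝ) := by exact_mod_cast hn
  obtain ⟨C, h⟩ := exists_A1c hμ
  have hC := h.one
  obtain ⟨K, hK, hosc⟩ := osc_bound hn h hβ0 hb
  obtain ⟨cp, hcp, hmax⟩ := maxN_strong (nuM_good h) p hp1
  have ha : 0 < β / n := by positivity
  have hq0 : 0 < q := by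
    have : 0 < 1 / q := by
      rw [hq, sub_pos, div_lt_div_iff₀ hn' hp0]
      rw [lt_div_iff₀ hβ0] at hpn
      linarith
    exact one_div_pos.1 this
  set K1 := (2 * K * C) ^ q * 2 ^ q * ((C * 4 ^ n) ^ p * cp.toReal * (C * 4 ^ n) ^ (κ * q / p) +
        (C * 4 ^ n) ^ (1 - κ * q / p)) with hK1
  have hcp0 : 0 ≤ cp.toReal := ENNReal.toReal_nonneg
  have hK10 : 0 ≤ K1 := by positivity
  refine ⟨K1 ^ (1/q) + 1, by positivity, fun f hf => ?_⟩
  set A := morreyNorm p κ μ f with hAdef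
  have hA : 0 ≤ A := by
    apply Real.sSup_nonneg
    rintro s ⟨Q, hQ, rfl⟩
    have h1 : 0 ≤ ∫ x in Q, μ x := integral_nonneg h.nn
    have h2 : 0 ≤ ∫ x in Q, |f x| ^ p * μ x :=
      integral_nonneg fun x => mul_nonneg (by positivity) (h.nn x)
    positivity
  have hP : ∀ c r, 0 < r → ∫ x in closedBall c r, |f x| ^ p * μ x ≤
      A ^ p * (∫ x in closedBall c r, μ x) ^ κ := by
    intro c r hr
    have hm := h.mpos c r hr
    have h2 : 0 ≤ ∫ x in closedBall c r, |f x| ^ p * μ x :=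
      integral_nonneg fun x => mul_nonneg (by positivity) (h.nn x)
    have h1 : _ ≤ A := le_csSup hf.2 ⟨closedBall c r, (isCube_iff _).2 ⟨c, r, hr, rfl⟩, rfl⟩
    have h3 := Real.rpow_le_rpow (by positivity) h1 hp0.le
    rw [← Real.rpow_mul (by positivity), one_div_mul_cancel hp0.ne', Real.rpow_one,
      Real.rpow_neg hm.le, inv_mul_le_iff₀ (by positivity)] at h3
    linarith
  have hcomm := comm_avg h hb.1 hK hosc (morrey_aem hp1 h hf) (morrey_int hp1 h hf)
  refine Real.sSup_le ?_ (by positivity)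
  rintro s ⟨Q, hQ, rfl⟩
  obtain ⟨c, r, hr, rfl⟩ := (isCube_iff _).1 hQ
  have hm := h.mpos c r hr
  have hcb := cube_bound hp1 ha hq hq0 hκ0 hκ hA (by positivity : 0 ≤ 2 * K * C) h hf hP hb0 hcomm cp hcp
    hmax c r hr
  rw [← hK1] at hcb
  have hI : 0 ≤ ∫ x in closedBall c r, |commM b f x| ^ q * μ x ^ (1 - q) :=
    integral_nonneg fun x => mul_nonneg (by positivity) (Real.rpow_nonneg (h.nn x) _)
  calc ((∫ x in closedBall c r, μ x) ^ (-(κ * q / p)) *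
      ∫ x in closedBall c r, |commM b f x| ^ q * μ x ^ (1 - q)) ^ (1 / q)
      ≤ (K1 * A ^ q) ^ (1 / q) := by
        refine Real.rpow_le_rpow (by positivity) ?_ (by positivity)
        rw [Real.rpow_neg hm.le, inv_mul_le_iff₀ (by positivity)]
        linarith
    _ = K1 ^ (1/q) * A := by
        rw [Real.mul_rpow hK10 (by positivity), ← Real.rpow_mul hA, mul_one_div_cancel hq0.ne',
          Real.rpow_one]
    _ ≤ _ := by gcongr; linarith

end Helpers

/-- `(1) ⇒ (2)` of Theorem 1.2: if `b ∈ Lip_{β,μ}` and `b ≥ 0` a.e., then `[b,M]`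
is bounded from `L^{p,κ}(μ)` to `L^{q,κq/p}(μ^{1-q},μ)`. -/
theorem commM_bounded
    (n : ℕ) (hn : 1 ≤ n) (μ : (Fin n → ℝ) → ℝ) (hμ : IsA1 μ)
    (β p q κ : ℝ) (hβ0 : 0 < β) (hβ1 : β < 1)
    (hp1 : 1 < p) (hpn : p < n / β)
    (hq : 1 / q = 1 / p - β / n) (hκ0 : 0 < κ) (hκ : κ < p / q)
    (b : (Fin n → ℝ) → ℝ) (hb : MemLip β μ b)
    (hb0 : ∀ᵐ x ∂(MeasureTheory.volume : Measure (Fin n → ℝ)), 0 ≤ b x) :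
    ∃ C > 0, ∀ f : (Fin n → ℝ) → ℝ, MemMorrey p κ μ f →
      morreyNorm2 q (κ * q / p) (fun x => μ x ^ (1 - q)) μ (commM b f) ≤
        C * morreyNorm p κ μ f := by
  exact commM_bounded_aux n hn μ hμ β p q κ hβ0 hp1 hpn hq hκ0 hκ b hb hb0

end
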